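/- arXiv:2407.05462 — 2 statements merged into one kernel-verified Lean document; each statement's English description precedes it below -/
import Mathlib

section
/- Bruhat decomposition of Timmesfeld's group SL₂(L): the group SL₂(L) equals B ∪ B·w·B, and moreover this union is disjoint (no element of B·w·B lies in B). -/
open Matrix Pointwise

noncomputable section

variable {K : Type*} [Field K]

abbrev SL2 (K : Type*) [Field K] := Matrix.SpecialLinearGroup (Fin 2) K

/-- `a(t) = [[1,t],[0,1]]`. -/
def aMat (t : K) : SL2 K :=
  ⟨!![1, t; 0, 1], by simp [Matrix.det_fin_two_of]⟩

/-- `b(t) = [[1,0],[t,1]]`. -/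
def bMat (t : K) : SL2 K :=
  ⟨!![1, 0; t, 1], by simp [Matrix.det_fin_two_of]⟩

/-- `diag(s) = [[s,0],[0,s⁻¹]]`. -/
def diagMat (s : Kˣ) : SL2 K :=
  ⟨!![(s : K), 0; 0, ((s⁻¹ : Kˣ) : K)], by simp [Matrix.det_fin_two_of]⟩

/-- `w = [[0,1],[1,0]]`, in `SL₂` since `char K = 2`. -/
def wMat (K : Type*) [Field K] [CharP K 2] : SL2 K :=
  ⟨!![0, 1; 1, 0], by simp [Matrix.det_fin_two_of, CharTwo.neg_eq]⟩

def setA (L : AddSubgroup K) : Set (SL2 K) := {g | ∃ t ∈ L, g = aMat t}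

def setAop (L : AddSubgroup K) : Set (SL2 K) := {g | ∃ t ∈ L, g = bMat t}

/-- Timmesfeld's `SL₂(L)`. -/
def SL2L (L : AddSubgroup K) : Subgroup (SL2 K) := Subgroup.closure (setA L ∪ setAop L)

/-- The subgroup of `Kˣ` generated by the nonzero elements of `L`. -/
def Tgen (L : AddSubgroup K) : Subgroup Kˣ := Subgroup.closure {u : Kˣ | (u : K) ∈ L}

def setTL (L : AddSubgroup K) : Set (SL2 K) := {g | ∃ s ∈ Tgen L, g = diagMat s}

def setTK (K : Type*) [Field K] : Set (SL2 K) := {g | ∃ s : Kˣ, g = diagMat s}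

def setB (L : AddSubgroup K) : Set (SL2 K) := setTL L * setA L


theorem val_mul (g h : SL2 K) : (g * h).1 = g.1 * h.1 := rfl

theorem c_aMat (t : K) : (aMat t).1 = !![1, t; 0, 1] := rfl

theorem c_bMat (t : K) : (bMat t).1 = !![1, 0; t, 1] := rfl

theorem c_diagMat (s : Kˣ) : (diagMat s).1 = !![(s : K), 0; 0, ((s⁻¹ : Kˣ) : K)] := rfl

theorem c_wMat [CharP K 2] : (wMat K).1 = !![0, 1; 1, 0] := rfl

def TT (L : AddSubgroup K) (x : K) : Prop := ∃ u ∈ Tgen L, (u : K) = x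

theorem TT.ne {L : AddSubgroup K} {x : K} (h : TT L x) : x ≠ 0 := by
  obtain ⟨u, _, rfl⟩ := h; exact u.ne_zero

theorem TT.mul {L : AddSubgroup K} {x y : K} (h : TT L x) (h' : TT L y) : TT L (x * y) := by
  obtain ⟨u, hu, rfl⟩ := h
  obtain ⟨v, hv, rfl⟩ := h'
  exact ⟨u * v, mul_mem hu hv, by simp⟩

theorem TT.of_mem {L : AddSubgroup K} {x : K} (h : x ∈ L) (h0 : x ≠ 0) : TT L x :=
  ⟨Units.mk0 x h0, Subgroup.subset_closure (by simpa using h), rfl⟩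

theorem sl_det (g : SL2 K) : g.1 0 0 * g.1 1 1 - g.1 0 1 * g.1 1 0 = 1 := by
  have := g.2
  rwa [Matrix.det_fin_two] at this

theorem mem_setB (L : AddSubgroup K) (g : SL2 K) :
    g ∈ setB L ↔ g.1 1 0 = 0 ∧ TT L (g.1 0 0) ∧ g.1 0 1 / g.1 0 0 ∈ L := by
  constructor
  · rintro ⟨_, ⟨s, hs, rfl⟩, _, ⟨t, ht, rfl⟩, rfl⟩
    refine ⟨by simp [val_mul, Matrix.mul_apply, Fin.sum_univ_two, c_diagMat, c_aMat], ⟨s, hs, by simp [val_mul, Matrix.mul_apply, Fin.sum_univ_two, c_diagMat, c_aMat]⟩, ?_⟩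
    simpa [val_mul, Matrix.mul_apply, Fin.sum_univ_two, c_diagMat, c_aMat] using ht
  · rintro ⟨h0, ⟨s, hs, h1⟩, h2⟩
    refine ⟨_, ⟨s, hs, rfl⟩, _, ⟨_, h2, rfl⟩, ?_⟩
    have hd := sl_det g
    have hs0 := s.ne_zero
    rw [h0, ← h1] at hd
    apply Subtype.ext
    ext i j
    fin_cases i <;> fin_cases j <;> simp [val_mul, Matrix.mul_apply, Fin.sum_univ_two, c_diagMat, c_aMat, ← h1, h0]
    · field_simp
    · field_simp
      linear_combination -hd

theorem mem_BwB [CharP K 2] (L : AddSubgroup K)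
    (hvs : ∀ s t : K, t ∈ L → s ^ 2 * t ∈ L) (h0L : (0 : K) ∈ L) (g : SL2 K) :
    g ∈ setB L * ({wMat K} : Set (SL2 K)) * setB L ↔
      TT L (g.1 1 0) ∧ g.1 0 0 / g.1 1 0 ∈ L ∧ g.1 1 1 / g.1 1 0 ∈ L := by
  constructor
  · rintro ⟨_, ⟨_, ⟨_, ⟨s, hs, rfl⟩, _, ⟨t, ht, rfl⟩, rfl⟩, _, rfl, rfl⟩,
      _, ⟨_, ⟨r, hr, rfl⟩, _, ⟨u, hu, rfl⟩, rfl⟩, rfl⟩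
    have hs0 := s.ne_zero
    have hr0 := r.ne_zero
    refine ⟨⟨s⁻¹ * r, mul_mem (inv_mem hs) hr, by simp [val_mul, Matrix.mul_apply, Fin.sum_univ_two, c_diagMat, c_aMat, c_wMat]⟩, ?_, ?_⟩
    · have := hvs s t ht
      convert this using 1
      simp [val_mul, Matrix.mul_apply, Fin.sum_univ_two, c_diagMat, c_aMat, c_wMat]
      field_simp
    · convert hu using 1
      simp [val_mul, Matrix.mul_apply, Fin.sum_univ_two, c_diagMat, c_aMat, c_wMat]
      field_simp
  · rintro ⟨⟨s, hs, h1⟩, h2, h3⟩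
    have hs0 := s.ne_zero
    have hd := sl_det g
    have h2' := hvs s _ h2
    rw [← h1] at h2' h3 hd
    refine ⟨_, ⟨_, ⟨_, ⟨s⁻¹, inv_mem hs, rfl⟩, _, ⟨_, h2', rfl⟩, rfl⟩, _, rfl, rfl⟩,
      _, ⟨_, ⟨1, one_mem _, rfl⟩, _, ⟨_, h3, rfl⟩, rfl⟩, ?_⟩
    have h2c : (2 : K) = 0 := CharTwo.two_eq_zero
    apply Subtype.ext
    ext i j
    fin_cases i <;> fin_cases j <;> simp [val_mul, Matrix.mul_apply, Fin.sum_univ_two, c_diagMat, c_aMat, c_wMat, ← h1]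
    · field_simp
    · field_simp
      linear_combination hd + h2c
    · field_simp

theorem diag_mem [CharP K 2] (L : AddSubgroup K) (hsq : ∀ x : K, x ^ 2 ∈ L)
    (hvs : ∀ s t : K, t ∈ L → s ^ 2 * t ∈ L) :
    wMat K ∈ SL2L L ∧ ∀ s ∈ Tgen L, diagMat s ∈ SL2L L := by
  have h2c : (2 : K) = 0 := CharTwo.two_eq_zero
  have ha : ∀ t ∈ L, aMat t ∈ SL2L L := fun t ht =>
    Subgroup.subset_closure (Or.inl ⟨t, ht, rfl⟩)
  have hb : ∀ t ∈ L, bMat t ∈ SL2L L := fun t ht =>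
    Subgroup.subset_closure (Or.inr ⟨t, ht, rfl⟩)
  have h1 : (1 : K) ∈ L := by simpa using hsq 1
  have hw : wMat K ∈ SL2L L := by
    have : wMat K = aMat 1 * bMat 1 * aMat 1 := by
      apply Subtype.ext
      ext i j
      fin_cases i <;> fin_cases j <;> simp [val_mul, Matrix.mul_apply, Fin.sum_univ_two, c_bMat, c_aMat, c_wMat] <;> grind
    rw [this]
    exact mul_mem (mul_mem (ha _ h1) (hb _ h1)) (ha _ h1)
  refine ⟨hw, fun s hs => ?_⟩
  induction hs using Subgroup.closure_induction with
  | mem s hs =>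
    have hs0 := s.ne_zero
    have hi : (s : K)⁻¹ ∈ L := by
      have := hvs (s : K)⁻¹ _ hs
      convert this using 1
      field_simp
    have : diagMat s = aMat (s : K) * bMat (s : K)⁻¹ * aMat (s : K) * wMat K := by
      apply Subtype.ext
      ext i j
      fin_cases i <;> fin_cases j <;> simp [val_mul, Matrix.mul_apply, Fin.sum_univ_two, c_bMat, c_aMat, c_wMat, c_diagMat] <;> grind
    rw [this]
    exact mul_mem (mul_mem (mul_mem (ha _ hs) (hb _ hi)) (ha _ hs)) hw
  | one =>
    have : diagMat (1 : Kˣ) = 1 := by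
      apply Subtype.ext
      ext i j
      fin_cases i <;> fin_cases j <;> simp [val_mul, Matrix.mul_apply, Fin.sum_univ_two, c_diagMat]
    rw [this]; exact one_mem _
  | mul x y _ _ hx hy =>
    have : diagMat (x * y) = diagMat x * diagMat y := by
      apply Subtype.ext
      ext i j
      fin_cases i <;> fin_cases j <;> simp [val_mul, Matrix.mul_apply, Fin.sum_univ_two, c_diagMat, mul_comm]
    rw [this]; exact mul_mem hx hy
  | inv x _ hx =>
    have : diagMat x⁻¹ = (diagMat x)⁻¹ := by
      rw [eq_inv_iff_mul_eq_one]
      apply Subtype.ext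
      ext i j
      fin_cases i <;> fin_cases j <;> simp [val_mul, Matrix.mul_apply, Fin.sum_univ_two, c_diagMat]
    rw [this]; exact inv_mem hx

/-- Entry-wise description of the union of the two cells. -/
def PP (L : AddSubgroup K) (g : SL2 K) : Prop :=
  (g.1 1 0 = 0 ∧ TT L (g.1 0 0) ∧ g.1 0 1 / g.1 0 0 ∈ L) ∨
    (TT L (g.1 1 0) ∧ g.1 0 0 / g.1 1 0 ∈ L ∧ g.1 1 1 / g.1 1 0 ∈ L)

theorem PP_a (L : AddSubgroup K)
    (hvs : ∀ s t : K, t ∈ L → s ^ 2 * t ∈ L) (g : SL2 K) (hg : PP L g) (t : K) (ht : t ∈ L) :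
    PP L (aMat t * g) := by
  have hd := sl_det g
  rcases hg with ⟨h0, h1, h2⟩ | ⟨h0, h1, h2⟩
  · left
    have := h1.ne
    refine ⟨by simp [val_mul, Matrix.mul_apply, Fin.sum_univ_two, c_aMat, h0, Matrix.mul_apply, Fin.sum_univ_two], by simpa [val_mul, Matrix.mul_apply, Fin.sum_univ_two, c_aMat, h0, Matrix.mul_apply, Fin.sum_univ_two] using h1, ?_⟩
    have h3 := add_mem h2 (hvs (g.1 0 0)⁻¹ t ht)
    convert h3 using 1
    rw [h0] at hd
    simp only [val_mul, Matrix.mul_apply, Fin.sum_univ_two, c_aMat, h0, Matrix.mul_apply, Fin.sum_univ_two, SpecialLinearGroup.coe_mul]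
    simp [h0]
    field_simp
    linear_combination t * hd
  · right
    have := h0.ne
    refine ⟨by simpa [val_mul, Matrix.mul_apply, Fin.sum_univ_two, c_aMat, Matrix.mul_apply, Fin.sum_univ_two] using h0, ?_, by simpa [val_mul, Matrix.mul_apply, Fin.sum_univ_two, c_aMat, Matrix.mul_apply, Fin.sum_univ_two] using h2⟩
    have h3 := add_mem h1 ht
    convert h3 using 1
    simp [val_mul, Matrix.mul_apply, Fin.sum_univ_two, c_aMat, Matrix.mul_apply, Fin.sum_univ_two]
    field_simp

theorem PP_w [CharP K 2] (L : AddSubgroup K) (h0L : (0 : K) ∈ L)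
    (hvs : ∀ s t : K, t ∈ L → s ^ 2 * t ∈ L) (g : SL2 K) (hg : PP L g) :
    PP L (wMat K * g) := by
  have hd := sl_det g
  have e00 : (wMat K * g).1 0 0 = g.1 1 0 := by simp [val_mul, Matrix.mul_apply, Fin.sum_univ_two, c_wMat, Matrix.mul_apply, Fin.sum_univ_two]
  have e01 : (wMat K * g).1 0 1 = g.1 1 1 := by simp [val_mul, Matrix.mul_apply, Fin.sum_univ_two, c_wMat, Matrix.mul_apply, Fin.sum_univ_two]
  have e10 : (wMat K * g).1 1 0 = g.1 0 0 := by simp [val_mul, Matrix.mul_apply, Fin.sum_univ_two, c_wMat, Matrix.mul_apply, Fin.sum_univ_two]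
  have e11 : (wMat K * g).1 1 1 = g.1 0 1 := by simp [val_mul, Matrix.mul_apply, Fin.sum_univ_two, c_wMat, Matrix.mul_apply, Fin.sum_univ_two]
  unfold PP
  rw [e00, e01, e10, e11]
  rcases hg with ⟨h0, h1, h2⟩ | ⟨h0, h1, h2⟩
  · right
    exact ⟨h1, by simpa [h0] using h0L, h2⟩
  · have hc := h0.ne
    by_cases ha : g.1 0 0 = 0
    · left
      exact ⟨ha, h0, h2⟩
    · right
      have hi : g.1 1 0 / g.1 0 0 ∈ L := by
        have := hvs (g.1 1 0 / g.1 0 0) _ h1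
        convert this using 1
        field_simp
      refine ⟨?_, hi, ?_⟩
      · have := (TT.of_mem h1 (div_ne_zero ha hc)).mul h0
        rwa [div_mul_cancel₀ _ hc] at this
      · have := sub_mem h2 (hvs (g.1 1 0)⁻¹ _ hi)
        convert this using 1
        field_simp
        linear_combination -hd

theorem PP_b [CharP K 2] (L : AddSubgroup K) (h0L : (0 : K) ∈ L)
    (hvs : ∀ s t : K, t ∈ L → s ^ 2 * t ∈ L) (g : SL2 K) (hg : PP L g) (t : K) (ht : t ∈ L) :
    PP L (bMat t * g) := by
  have : bMat t * g = wMat K * (aMat t * (wMat K * g)) := by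
    simp only [← mul_assoc]
    congr 1
    apply Subtype.ext
    ext i j
    fin_cases i <;> fin_cases j <;> simp [val_mul, Matrix.mul_apply, Fin.sum_univ_two, c_bMat, c_aMat, c_wMat]
  rw [this]
  exact PP_w L h0L hvs _ (PP_a L hvs _ (PP_w L h0L hvs _ hg) t ht)

theorem aMat_inv (t : K) : (aMat t)⁻¹ = aMat (-t) := by
  rw [inv_eq_iff_mul_eq_one]
  apply Subtype.ext
  ext i j
  fin_cases i <;> fin_cases j <;> simp [val_mul, Matrix.mul_apply, Fin.sum_univ_two, c_aMat]

theorem bMat_inv (t : K) : (bMat t)⁻¹ = bMat (-t) := by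
  rw [inv_eq_iff_mul_eq_one]
  apply Subtype.ext
  ext i j
  fin_cases i <;> fin_cases j <;> simp [val_mul, Matrix.mul_apply, Fin.sum_univ_two, c_bMat]

/-- **Bruhat decomposition of Timmesfeld's `SL₂(L)`**: with `B = T(L)·A` and
`w = [[0,1],[1,0]]`, we have `SL₂(L) = B ∪ BwB`, and the union is disjoint. -/
theorem bruhat_decomposition_SL2L
    [CharP K 2] (himperf : ¬ Function.Surjective fun x : K => x ^ 2)
    (L : AddSubgroup K) (hsq : ∀ x : K, x ^ 2 ∈ L)
    (hvs : ∀ s t : K, t ∈ L → s ^ 2 * t ∈ L) :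
    ((SL2L L : Set (SL2 K)) = setB L ∪ setB L * {wMat K} * setB L) ∧
      ∀ x ∈ setB L * ({wMat K} : Set (SL2 K)) * setB L, x ∉ setB L := by
  have h0L := L.zero_mem
  refine ⟨?_, ?_⟩
  · apply Set.Subset.antisymm
    · intro g hg
      have key : PP L g := by
        induction hg using Subgroup.closure_induction_left with
        | one =>
          left
          refine ⟨by simp, ⟨1, one_mem _, by simp⟩, by simpa using h0L⟩
        | mul_left x hx y _ ih =>
          rcases hx with ⟨t, ht, rfl⟩ | ⟨t, ht, rfl⟩
          · exact PP_a L hvs _ ih t ht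
          · exact PP_b L h0L hvs _ ih t ht
        | inv_mul_cancel x hx y _ ih =>
          rcases hx with ⟨t, ht, rfl⟩ | ⟨t, ht, rfl⟩
          · rw [aMat_inv]; exact PP_a L hvs _ ih _ (neg_mem ht)
          · rw [bMat_inv]; exact PP_b L h0L hvs _ ih _ (neg_mem ht)
      rcases key with h | h
      · exact Or.inl ((mem_setB L g).2 h)
      · exact Or.inr ((mem_BwB L hvs h0L g).2 h)
    · obtain ⟨hw, hT⟩ := diag_mem L hsq hvs
      have hB : ∀ g ∈ setB L, g ∈ SL2L L := by
        rintro _ ⟨_, ⟨s, hs, rfl⟩, _, ⟨t, ht, rfl⟩, rfl⟩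
        exact mul_mem (hT s hs) (Subgroup.subset_closure (Or.inl ⟨t, ht, rfl⟩))
      rintro g (hg | ⟨_, ⟨x, hx, _, rfl, rfl⟩, y, hy, rfl⟩)
      · exact hB g hg
      · exact mul_mem (mul_mem (hB x hx) hw) (hB y hy)
  · intro x hx hx'
    exact ((mem_BwB L hvs h0L x).1 hx).1.ne ((mem_setB L x).1 hx').1

end
end

section
/- The set of upper unitriangular matrices belonging to SL₂(L) is exactly A; that is, for t ∈ K, the matrix a(t) = [[1,t],[0,1]] lies in SL₂(L) if and only if t ∈ L. -/
open Matrix Pointwise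

noncomputable section

variable {K : Type*} [Field K]

/-- The upper unitriangular matrices in `SL₂(L)` are exactly `A`:
`a(t) ∈ SL₂(L)` iff `t ∈ L`. -/
theorem unitriangular_of_SL2L
    [CharP K 2] (himperf : ¬ Function.Surjective fun x : K => x ^ 2)
    (L : AddSubgroup K) (hsq : ∀ x : K, x ^ 2 ∈ L)
    (hvs : ∀ s t : K, t ∈ L → s ^ 2 * t ∈ L) :
    ∀ t : K, aMat t ∈ SL2L L ↔ t ∈ L := by
  intro t
  constructor
  swap
  · intro ht
    exact Subgroup.subset_closure (Or.inl ⟨t, ht, rfl⟩)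
  intro h
  have key : ∀ g ∈ SL2L L, ∀ v : Fin 2 → K,
      ((g.1 *ᵥ v) 0 * (g.1 *ᵥ v) 1 ∈ L ↔ v 0 * v 1 ∈ L) := by
    intro g hg
    unfold SL2L at hg
    induction hg using Subgroup.closure_induction with
    | mem x hx =>
      intro v
      rcases hx with ⟨u, hu, rfl⟩ | ⟨u, hu, rfl⟩
      · have e : ((aMat u).1 *ᵥ v) 0 * ((aMat u).1 *ᵥ v) 1 = v 0 * v 1 + (v 1) ^ 2 * u := by
          simp [aMat, Matrix.mulVec, dotProduct, Fin.sum_univ_two]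
          ring
        rw [e]
        exact AddSubgroup.add_mem_cancel_right L (hvs _ _ hu)
      · have e : ((bMat u).1 *ᵥ v) 0 * ((bMat u).1 *ᵥ v) 1 = v 0 * v 1 + (v 0) ^ 2 * u := by
          simp [bMat, Matrix.mulVec, dotProduct, Fin.sum_univ_two]
          ring
        rw [e]
        exact AddSubgroup.add_mem_cancel_right L (hvs _ _ hu)
    | one => intro v; simp
    | mul x y _ _ hx hy =>
      intro v
      have e : (x * y).1 *ᵥ v = x.1 *ᵥ (y.1 *ᵥ v) := by
        rw [Matrix.mulVec_mulVec]; rfl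
      rw [e, hx, hy]
    | inv x _ hx =>
      intro v
      have e : x.1 *ᵥ ((x⁻¹).1 *ᵥ v) = v := by
        have e1 : x.1 * (x⁻¹).1 = 1 := congrArg Subtype.val (mul_inv_cancel x)
        rw [Matrix.mulVec_mulVec, e1, Matrix.one_mulVec]
      have := hx ((x⁻¹).1 *ᵥ v)
      rw [e] at this
      exact this.symm
  have := (key _ h ![0, 1]).2 (by simp)
  simpa [aMat, Matrix.mulVec, dotProduct, Fin.sum_univ_two] using this

end
end
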